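/- arXiv:2407.08293 — 4 statements merged into one kernel-verified Lean document; each statement's English description precedes it below -/
import Mathlib

section
/- Suppose α ∈ G_k + H_i for some k ∈ ℕ and i ∈ ℕ₀, and let m = max(k, m_i). Then there exists a unique permissible coefficient vector (L,N) ∈ ℤ^m × ℤ^i such that α = |(L,N)|. -/
/-! Core combinatorial definitions for the jumping-polynomial construction. -/

namespace Jump

/-- Tuples of nonnegative integers, indexed by positive integers (index 0 unused). -/
abbrev Vec := ℕ → ℕ

/-- Pairs of tuples. -/
abbrev PVec := Vec × Vec

/-- `A` is a tuple in `ℕ₀^k` (entries indexed by `1, …, k`). -/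
def Supp (k : ℕ) (A : Vec) : Prop := ∀ j : ℕ, (j = 0 ∨ k < j) → A j = 0

/-- `A` is a tuple in `ℤ^k` (entries indexed by `1, …, k`). -/
def SuppZ (k : ℕ) (A : ℕ → ℤ) : Prop := ∀ j : ℕ, (j = 0 ∨ k < j) → A j = 0

/-- `(A, C)` is irreducible with respect to a set `T` of pairs of tuples: no member of `T`
is componentwise less than or equal to `(A, C)`. -/
def Irr (T : Set PVec) (p : PVec) : Prop := ∀ bd ∈ T, ¬ (bd.1 ≤ p.1 ∧ bd.2 ≤ p.2)

/-- The weight `A·β(k) = a₁β₁ + ⋯ + a_kβ_k` of a tuple of nonnegative integers. -/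
noncomputable def wtA (β : ℕ → ℝ) (k : ℕ) (A : Vec) : ℝ :=
  ∑ j ∈ Finset.Icc 1 k, (A j : ℝ) * β j

/-- The weight of a tuple of integers. -/
noncomputable def wtZ (β : ℕ → ℝ) (k : ℕ) (A : ℕ → ℤ) : ℝ :=
  ∑ j ∈ Finset.Icc 1 k, (A j : ℝ) * β j

/-- The weight `|(A, C)| = A·β(k) + C·γ(i)` of a pair of tuples. -/
noncomputable def wt (β γ : ℕ → ℝ) (k i : ℕ) (p : PVec) : ℝ :=
  wtA β k p.1 + wtA γ i p.2

/-- The group `G_n = β₁ℤ + ⋯ + β_nℤ` (as a subset of `ℝ`; `G_0 = {0}`). -/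
noncomputable def Gr (β : ℕ → ℝ) (n : ℕ) : Set ℝ :=
  {t | ∃ A : ℕ → ℤ, SuppZ n A ∧ t = wtZ β n A}

/-- The semigroup `S_n = β₁ℕ₀ + ⋯ + β_nℕ₀` (as a subset of `ℝ`; `S_0 = {0}`). -/
noncomputable def Sg (β : ℕ → ℝ) (n : ℕ) : Set ℝ :=
  {t | ∃ A : Vec, Supp n A ∧ t = wtA β n A}

/-- The set `G_k + H_i`. -/
noncomputable def GrH (β γ : ℕ → ℝ) (k i : ℕ) : Set ℝ :=
  {t | ∃ a ∈ Gr β k, ∃ b ∈ Gr γ i, t = a + b}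

/-- The set `G + H_i`, where `G = ⋃_{n ≤ len} G_n`. -/
noncomputable def GH (β γ : ℕ → ℝ) (len : ℕ∞) (i : ℕ) : Set ℝ :=
  {t | ∃ k : ℕ, (k : ℕ∞) ≤ len ∧ t ∈ GrH β γ k i}

/-- The set `S_k + U_i`. -/
noncomputable def SU (β γ : ℕ → ℝ) (k i : ℕ) : Set ℝ :=
  {t | ∃ a ∈ Sg β k, ∃ b ∈ Sg γ i, t = a + b}

/-- The `j`-th standard basis vector `E_j`. -/
def unitVec (j : ℕ) : Vec := fun l => if l = j then 1 else 0

/-- The set `𝒫 = {(q_jE_j, 0̄) : j ≥ 2, q_j < ∞}`. -/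
def Pset (q : ℕ → ℕ∞) : Set PVec :=
  {p | ∃ j : ℕ, 2 ≤ j ∧ ∃ t : ℕ, q j = (t : ℕ∞) ∧
        p = (fun l => t * unitVec j l, fun _ => 0)}

/-- `(A, C) ∈ ℕ₀^{m_i} × ℕ₀^i` pushes `γ_i`: `c_i > 0` and `|(A, C)| ∈ S_{m_i} + U_{i-1}`. -/
noncomputable def Push (β γ : ℕ → ℝ) (mi i : ℕ) (p : PVec) : Prop :=
  0 < p.2 i ∧ wt β γ mi i p ∈ SU β γ mi (i - 1)

/-- `(A, C)` is reduced: it pushes `γ_i` and no pair strictly below it (componentwise) does. -/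
noncomputable def Red (β γ : ℕ → ℝ) (mi i : ℕ) (p : PVec) : Prop :=
  Push β γ mi i p ∧
    ∀ p' : PVec, p'.1 ≤ p.1 → p'.2 ≤ p.2 → p' ≠ p → ¬ Push β γ mi i p'

/-- The set `𝒟_i`, built from `𝒯_i`: empty if `s_i = ∞`, otherwise the pairs in
`ℕ₀^{m_i} × ℕ₀^i` that are irreducible with respect to `𝒯_i` and reduced. -/
noncomputable def Dstep (β γ : ℕ → ℝ) (s : ℕ → ℕ∞) (m : ℕ → ℕ) (i : ℕ)
    (Ti : Set PVec) : Set PVec :=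
  if s i = ⊤ then ∅ else
    {p | Supp (m i) p.1 ∧ Supp i p.2 ∧ Irr Ti p ∧ Red β γ (m i) i p}

/-- The chain `𝒯_1 = 𝒫`, `𝒯_{i+1} = 𝒯_i ∪ 𝒟_i` (here `Tchain 0 = Tchain 1 = 𝒫`,
which is forced by the convention `s 0 = ⊤`). -/
noncomputable def Tchain (β γ : ℕ → ℝ) (q s : ℕ → ℕ∞) (m : ℕ → ℕ) : ℕ → Set PVec
  | 0 => Pset q
  | n + 1 => Tchain β γ q s m n ∪ Dstep β γ s m n (Tchain β γ q s m n)

/-- The set `𝒯 = ⋃_i 𝒯_i`. -/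
noncomputable def Tfull (β γ : ℕ → ℝ) (q s : ℕ → ℕ∞) (m : ℕ → ℕ) : Set PVec :=
  ⋃ n, Tchain β γ q s m n

/-- A tuple `A ∈ ℤ^k` is permissible: `0 ≤ a_j < q_j` for all `1 ≤ j ≤ k` with `q_j < ∞`. -/
def PermZ (q : ℕ → ℕ∞) (k : ℕ) (A : ℕ → ℤ) : Prop :=
  ∀ j : ℕ, 1 ≤ j → j ≤ k → ∀ t : ℕ, q j = (t : ℕ∞) → 0 ≤ A j ∧ A j < (t : ℤ)

/-- A tuple `A ∈ ℕ₀^k` is permissible: `a_j < q_j` for all `1 ≤ j ≤ k` with `q_j < ∞`. -/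
def PermN (q : ℕ → ℕ∞) (k : ℕ) (A : Vec) : Prop :=
  ∀ j : ℕ, 1 ≤ j → j ≤ k → ∀ t : ℕ, q j = (t : ℕ∞) → A j < t

/-- The abstract combinatorial setup of the jumping-polynomial construction:
a finite (of length `len`) or infinite (`len = ⊤`) sequence `β` of positive reals,
a sequence `γ` of nonnegative reals, and the derived data `q_j`, `s_i`, `m_i`
defined by their minimality properties. -/
structure Setup where
  /-- the length of the `β`-sequence (possibly `∞`) -/
  len : ℕ∞
  β : ℕ → ℝ
  γ : ℕ → ℝ
  q : ℕ → ℕ∞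
  s : ℕ → ℕ∞
  m : ℕ → ℕ
  hlen : 2 ≤ len
  hβ : ∀ j : ℕ, 1 ≤ j → (j : ℕ∞) ≤ len → 0 < β j
  hγ : ∀ i : ℕ, 1 ≤ i → 0 ≤ γ i
  hq1 : q 1 = ⊤
  hqtop : ∀ j : ℕ, len < (j : ℕ∞) → q j = ⊤
  hq : ∀ j : ℕ, 2 ≤ j → (j : ℕ∞) ≤ len →
    q j = sInf {x : ℕ∞ | ∃ t : ℕ, x = (t : ℕ∞) ∧ 0 < t ∧ (t : ℝ) * β j ∈ Gr β (j - 1)}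
  /-- if `q_j = ∞` then `β_j` is the last term of the `β`-sequence, and conversely -/
  hlast : ∀ j : ℕ, 2 ≤ j → (j : ℕ∞) ≤ len → (q j = ⊤ ↔ len = (j : ℕ∞))
  /-- `β_{j+1} > q_jβ_j` whenever `q_j < ∞` -/
  hgrow : ∀ j : ℕ, 2 ≤ j → (j : ℕ∞) ≤ len → ∀ t : ℕ, q j = (t : ℕ∞) →
    (t : ℝ) * β j < β (j + 1)
  hs0 : s 0 = ⊤
  hs : ∀ i : ℕ, 1 ≤ i →
    s i = sInf {x : ℕ∞ | ∃ t : ℕ, x = (t : ℕ∞) ∧ 0 < t ∧ (t : ℝ) * γ i ∈ GH β γ len (i - 1)}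
  hm0 : m 0 = 1
  hmtop : ∀ i : ℕ, 1 ≤ i → s i = ⊤ → m i = m (i - 1)
  hmfin : ∀ i : ℕ, 1 ≤ i → ∀ t : ℕ, s i = (t : ℕ∞) →
    m i = max (m (i - 1))
      (sInf {j : ℕ | 1 ≤ j ∧ (j : ℕ∞) ≤ len ∧ (t : ℝ) * γ i ∈ GrH β γ j (i - 1)})
  hmlen : ∀ i : ℕ, 1 ≤ m i ∧ ((m i : ℕ) : ℕ∞) ≤ len

end Jump

namespace Jump

lemma wtZ_zero (β : ℕ → ℝ) (A : ℕ → ℤ) : wtZ β 0 A = 0 := by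
  simp [wtZ]

lemma wtZ_succ (β : ℕ → ℝ) (n : ℕ) (A : ℕ → ℤ) :
    wtZ β (n + 1) A = wtZ β n A + (A (n + 1) : ℝ) * β (n + 1) :=
  Finset.sum_Icc_succ_top (by omega) _

lemma wtZ_congr {β : ℕ → ℝ} {n : ℕ} {A B : ℕ → ℤ}
    (h : ∀ j, 1 ≤ j → j ≤ n → A j = B j) : wtZ β n A = wtZ β n B :=
  Finset.sum_congr rfl fun j hj => by
    rw [Finset.mem_Icc] at hj
    rw [h j hj.1 hj.2]

lemma wtZ_update_succ (β : ℕ → ℝ) (n : ℕ) (A : ℕ → ℤ) (c : ℤ) :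
    wtZ β (n + 1) (Function.update A (n + 1) c) = wtZ β n A + (c : ℝ) * β (n + 1) := by
  rw [wtZ_succ, Function.update_self]
  congr 1
  exact wtZ_congr fun j _ hj => Function.update_of_ne (by omega) _ _

lemma wtZ_mem_Gr (β : ℕ → ℝ) (n : ℕ) (A : ℕ → ℤ) : wtZ β n A ∈ Gr β n := by
  refine ⟨fun j => if j = 0 ∨ n < j then 0 else A j, fun j hj => if_pos hj, ?_⟩
  exact wtZ_congr fun j h1 hn => (if_neg (by omega)).symm

lemma wtZ_of_suppZ {β : ℕ → ℝ} {n m : ℕ} (h : n ≤ m) {A : ℕ → ℤ} (hA : SuppZ n A) :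
    wtZ β m A = wtZ β n A := by
  refine (Finset.sum_subset (Finset.Icc_subset_Icc_right h) fun j hj hj' => ?_).symm
  rw [Finset.mem_Icc] at hj hj'
  rw [hA j (by omega)]
  simp

/-- `Gr β n` as an additive subgroup of `ℝ`. -/
noncomputable def grSubgroup (β : ℕ → ℝ) (n : ℕ) : AddSubgroup ℝ where
  carrier := Gr β n
  zero_mem' := ⟨0, fun _ _ => rfl, by simp [wtZ]⟩
  add_mem' := by
    rintro _ _ ⟨A, -, rfl⟩ ⟨B, -, rfl⟩
    have := wtZ_mem_Gr β n (A + B)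
    simpa [wtZ, add_mul, Finset.sum_add_distrib] using this
  neg_mem' := by
    rintro _ ⟨A, -, rfl⟩
    have := wtZ_mem_Gr β n (-A)
    simpa [wtZ] using this

lemma Gr_mono {β : ℕ → ℝ} {n m : ℕ} (h : n ≤ m) : Gr β n ⊆ Gr β m := by
  rintro _ ⟨A, hA, rfl⟩
  exact wtZ_of_suppZ (β := β) h hA ▸ wtZ_mem_Gr β m A

lemma mem_GrH_iff {β γ : ℕ → ℝ} {k i : ℕ} {t : ℝ} :
    t ∈ GrH β γ k i ↔ t ∈ grSubgroup β k ⊔ grSubgroup γ i := by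
  rw [AddSubgroup.mem_sup]
  constructor
  · rintro ⟨a, ha, b, hb, rfl⟩
    exact ⟨a, ha, b, hb, rfl⟩
  · rintro ⟨a, ha, b, hb, rfl⟩
    exact ⟨a, ha, b, hb, rfl⟩

lemma GrH_mono {β γ : ℕ → ℝ} {k l i : ℕ} (h : k ≤ l) : GrH β γ k i ⊆ GrH β γ l i := by
  rintro _ ⟨a, ha, b, hb, rfl⟩
  exact ⟨a, Gr_mono h ha, b, hb, rfl⟩

/-- Two integers in the fundamental range of the order `q` of `x` modulo `K` that agree
modulo `K` are equal. -/
lemma eq_of_sub_mul_mem {K : AddSubgroup ℝ} {q : ℕ∞} {x : ℝ}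
    (hq : ∀ t : ℕ, 0 < t → (t : ℝ) * x ∈ K → q ≤ t) {a b : ℤ}
    (ha : ∀ t : ℕ, q = t → 0 ≤ a ∧ a < t) (hb : ∀ t : ℕ, q = t → 0 ≤ b ∧ b < t)
    (hab : ((a - b : ℤ) : ℝ) * x ∈ K) : a = b := by
  by_contra hne
  wlog hlt : b < a generalizing a b
  · refine this hb ha ?_ (Ne.symm hne) (by omega)
    rw [← neg_sub a b, Int.cast_neg, neg_mul]
    exact neg_mem hab
  obtain ⟨t, ht⟩ := Int.eq_ofNat_of_zero_le (show 0 ≤ a - b by omega)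
  rw [ht] at hab
  have hle := hq t (by omega) (by simpa using hab)
  obtain ⟨t', ht'⟩ := ENat.ne_top_iff_exists.1 (ne_top_of_le_ne_top (ENat.natCast_ne_top t) hle)
  rw [← ht', Nat.cast_le] at hle
  have := ha t' ht'.symm
  have := hb t' ht'.symm
  omega

/-- Any integer can be reduced into the fundamental range of `q`. -/
lemma exists_reduced (q : ℕ∞) (hq : ∀ t : ℕ, q = t → 0 < t) (c : ℤ) :
    ∃ r : ℤ, (∀ t : ℕ, q = t → 0 ≤ r ∧ r < t) ∧
      (c = r ∨ ∃ t : ℕ, q = t ∧ ∃ e : ℤ, c = t * e + r) := by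
  induction q with
  | top => exact ⟨c, fun t ht => absurd ht (ENat.top_ne_natCast t), Or.inl rfl⟩
  | coe t =>
    have ht : (0 : ℤ) < t := by exact_mod_cast hq t rfl
    refine ⟨c % t, fun t' h => ?_, Or.inr ⟨t, rfl, c / t, (Int.mul_ediv_add_emod c t).symm⟩⟩
    obtain rfl : t = t' := by exact_mod_cast h
    exact ⟨Int.emod_nonneg _ ht.ne', Int.emod_lt_of_pos _ ht⟩

lemma mem_of_sInf_eq {P : ℕ → Prop} {t : ℕ}
    (h : sInf {x : ℕ∞ | ∃ t : ℕ, x = (t : ℕ∞) ∧ P t} = t) : P t := by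
  have hne : {x : ℕ∞ | ∃ t : ℕ, x = (t : ℕ∞) ∧ P t}.Nonempty := by
    rw [Set.nonempty_iff_ne_empty]
    intro he
    rw [he, sInf_empty] at h
    exact ENat.top_ne_natCast t h
  obtain ⟨t', ht', hP⟩ := csInf_mem hne
  rw [h] at ht'
  obtain rfl : t = t' := by exact_mod_cast ht'
  exact hP

namespace Setup

variable (d : Setup)

lemma q_le {j : ℕ} (hj : 1 ≤ j) (hjl : (j : ℕ∞) ≤ d.len) {t : ℕ} (ht : 0 < t)
    (h : (t : ℝ) * d.β j ∈ Gr d.β (j - 1)) : d.q j ≤ t := by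
  rcases hj.eq_or_lt with rfl | hj
  · obtain ⟨A, -, hA⟩ := h
    rw [wtZ_zero] at hA
    have := mul_pos (Nat.cast_pos.2 ht : (0 : ℝ) < t) (d.hβ 1 le_rfl hjl)
    exact absurd hA this.ne'
  · rw [d.hq j hj hjl]
    exact sInf_le ⟨t, rfl, ht, h⟩

lemma q_spec {j : ℕ} (hj : 1 ≤ j) (hjl : (j : ℕ∞) ≤ d.len) {t : ℕ} (h : d.q j = t) :
    0 < t ∧ (t : ℝ) * d.β j ∈ Gr d.β (j - 1) := by
  rcases hj.eq_or_lt with rfl | hj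
  · exact absurd (d.hq1.symm.trans h) (ENat.top_ne_natCast t)
  · rw [d.hq j hj hjl] at h
    exact mem_of_sInf_eq (P := fun t => 0 < t ∧ (t : ℝ) * d.β j ∈ Gr d.β (j - 1)) h

lemma s_le {i : ℕ} (hi : 1 ≤ i) {t : ℕ} (ht : 0 < t)
    (h : (t : ℝ) * d.γ i ∈ GH d.β d.γ d.len (i - 1)) : d.s i ≤ t := by
  rw [d.hs i hi]
  exact sInf_le ⟨t, rfl, ht, h⟩

lemma s_spec {i : ℕ} (hi : 1 ≤ i) {t : ℕ} (h : d.s i = t) :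
    0 < t ∧ (t : ℝ) * d.γ i ∈ GH d.β d.γ d.len (i - 1) := by
  rw [d.hs i hi] at h
  exact mem_of_sInf_eq (P := fun t => 0 < t ∧ (t : ℝ) * d.γ i ∈ GH d.β d.γ d.len (i - 1)) h

lemma m_pred_le {i : ℕ} (hi : 1 ≤ i) : d.m (i - 1) ≤ d.m i := by
  by_cases h : d.s i = ⊤
  · exact (d.hmtop i hi h).ge
  · obtain ⟨t, ht⟩ := ENat.ne_top_iff_exists.1 h
    rw [d.hmfin i hi t ht.symm]
    exact le_max_left _ _

/-- The relation witnessing `s_i < ∞` takes place in `G_{m_i} + H_{i-1}`. -/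
lemma s_mul_mem_GrH {i : ℕ} (hi : 1 ≤ i) {t : ℕ} (h : d.s i = t) :
    (t : ℝ) * d.γ i ∈ GrH d.β d.γ (d.m i) (i - 1) := by
  obtain ⟨-, k, hk, hmem⟩ := d.s_spec hi h
  have hne : {j : ℕ | 1 ≤ j ∧ (j : ℕ∞) ≤ d.len ∧
      (t : ℝ) * d.γ i ∈ GrH d.β d.γ j (i - 1)}.Nonempty := by
    refine ⟨max k 1, le_max_right _ _, ?_, GrH_mono (le_max_left _ _) hmem⟩
    rcases max_choice k 1 with h | h <;> rw [h]
    · exact hk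
    · exact le_trans (by norm_num) d.hlen
  rw [d.hmfin i hi t h]
  exact GrH_mono (le_max_right _ _) (Nat.sInf_mem hne).2.2

lemma exists_rep_Gr (n : ℕ) (hn : (n : ℕ∞) ≤ d.len) (α : ℝ) (hα : α ∈ Gr d.β n) :
    ∃ L, SuppZ n L ∧ PermZ d.q n L ∧ α = wtZ d.β n L := by
  induction n generalizing α with
  | zero =>
    obtain ⟨A, hA, rfl⟩ := hα
    exact ⟨A, hA, fun j h1 h2 => by omega, rfl⟩
  | succ n ih =>
    obtain ⟨A, -, rfl⟩ := hα
    obtain ⟨r, hr, hc⟩ := exists_reduced (d.q (n + 1))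
      (fun t ht => (d.q_spec (by omega) hn ht).1) (A (n + 1))
    have hmem : wtZ d.β (n + 1) A - (r : ℝ) * d.β (n + 1) ∈ grSubgroup d.β n := by
      rw [wtZ_succ]
      rcases hc with hc | ⟨t, ht, e, hc⟩
      · rw [hc, add_sub_cancel_right]
        exact wtZ_mem_Gr _ _ _
      · have hx : (t : ℝ) * d.β (n + 1) ∈ grSubgroup d.β n :=
          (d.q_spec (by omega) hn ht).2
        have := add_mem (show wtZ d.β n A ∈ grSubgroup d.β n from wtZ_mem_Gr _ _ _)
          (zsmul_mem hx e)
        rw [hc]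
        convert this using 1
        push_cast
        rw [zsmul_eq_mul]
        ring
    obtain ⟨L, hL, hP, hE⟩ := ih (le_trans (by exact_mod_cast n.le_succ) hn) _ hmem
    refine ⟨Function.update L (n + 1) r, fun j hj => ?_, fun j h1 h2 => ?_, ?_⟩
    · rw [Function.update_of_ne (by omega)]
      exact hL j (by omega)
    · rcases h2.eq_or_lt with rfl | h2
      · rwa [Function.update_self]
      · rw [Function.update_of_ne (by omega)]
        exact hP j h1 (by omega)
    · rw [wtZ_update_succ]
      linarith

lemma exists_rep (i k : ℕ) (hk : 1 ≤ k) (hkl : (k : ℕ∞) ≤ d.len) (α : ℝ)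
    (hα : α ∈ GrH d.β d.γ k i) :
    ∃ L N, SuppZ (max k (d.m i)) L ∧ SuppZ i N ∧ PermZ d.q (max k (d.m i)) L ∧
      PermZ d.s i N ∧ α = wtZ d.β (max k (d.m i)) L + wtZ d.γ i N := by
  induction i generalizing k α with
  | zero =>
    obtain ⟨a, ha, b, ⟨B, hB, rfl⟩, rfl⟩ := hα
    obtain ⟨L, hL, hP, rfl⟩ := d.exists_rep_Gr k hkl a ha
    rw [d.hm0, max_eq_left hk]
    exact ⟨L, B, hL, hB, hP, fun j h1 h2 => by omega, rfl⟩
  | succ i ih =>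
    obtain ⟨a, ha, b, ⟨B, -, rfl⟩, rfl⟩ := hα
    obtain ⟨r, hr, hc⟩ := exists_reduced (d.s (i + 1))
      (fun t ht => (d.s_spec (by omega) ht).1) (B (i + 1))
    have hbase {l : ℕ} (hl : k ≤ l) : a + wtZ d.γ i B ∈ grSubgroup d.β l ⊔ grSubgroup d.γ i :=
      mem_GrH_iff.1 ⟨a, Gr_mono hl ha, _, wtZ_mem_Gr _ _ _, rfl⟩
    obtain ⟨l, hkm, hll, hlm, hmem⟩ : ∃ l, k ≤ l ∧ (l : ℕ∞) ≤ d.len ∧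
        max l (d.m i) = max k (d.m (i + 1)) ∧
        a + wtZ d.γ (i + 1) B - (r : ℝ) * d.γ (i + 1) ∈
          grSubgroup d.β l ⊔ grSubgroup d.γ i := by
      have hle : d.m i ≤ d.m (i + 1) := d.m_pred_le (i := i + 1) (by omega)
      have hmax : ((max k (d.m (i + 1)) : ℕ) : ℕ∞) ≤ d.len := by
        rcases max_choice k (d.m (i + 1)) with h | h <;> rw [h]
        · exact hkl
        · exact (d.hmlen _).2
      refine ⟨max k (d.m (i + 1)), le_max_left _ _, hmax,
        max_eq_left (hle.trans (le_max_right _ _)), ?_⟩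
      rw [wtZ_succ]
      rcases hc with hc | ⟨t, ht, e, hc⟩
      · rw [hc, ← add_assoc, add_sub_cancel_right]
        exact hbase (le_max_left _ _)
      · have hx := mem_GrH_iff.1 (GrH_mono (le_max_right k _)
          (d.s_mul_mem_GrH (by omega) ht))
        have := add_mem (hbase (le_max_left k (d.m (i + 1)))) (zsmul_mem hx e)
        rw [hc]
        convert this using 1
        push_cast
        rw [zsmul_eq_mul]
        ring
    obtain ⟨L, N, hL, hN, hPL, hPN, hE⟩ := ih l (hk.trans hkm) hll _ (mem_GrH_iff.2 hmem)
    rw [hlm] at hL hPL hE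
    refine ⟨L, Function.update N (i + 1) r, hL, fun j hj => ?_, hPL, fun j h1 h2 => ?_, ?_⟩
    · rw [Function.update_of_ne (by omega)]
      exact hN j (by omega)
    · rcases h2.eq_or_lt with rfl | h2
      · rwa [Function.update_self]
      · rw [Function.update_of_ne (by omega)]
        exact hPN j h1 (by omega)
    · rw [wtZ_update_succ]
      linarith

lemma rep_Gr_unique (n : ℕ) (hn : (n : ℕ∞) ≤ d.len) {A B : ℕ → ℤ}
    (hA : PermZ d.q n A) (hB : PermZ d.q n B) (h : wtZ d.β n A = wtZ d.β n B) :
    ∀ j, 1 ≤ j → j ≤ n → A j = B j := by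
  induction n with
  | zero => omega
  | succ n ih =>
    rw [wtZ_succ, wtZ_succ] at h
    have hgr (A : ℕ → ℤ) : wtZ d.β n A ∈ grSubgroup d.β n := wtZ_mem_Gr _ _ _
    have htop : A (n + 1) = B (n + 1) := by
      refine eq_of_sub_mul_mem (K := grSubgroup d.β n)
        (fun t ht hm => d.q_le (by omega) hn ht hm)
        (hA (n + 1) (by omega) le_rfl) (hB (n + 1) (by omega) le_rfl) ?_
      have := sub_mem (hgr B) (hgr A)
      convert this using 1
      push_cast
      linarith
    rw [htop, add_left_inj] at h
    intro j h1 h2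
    rcases h2.eq_or_lt with rfl | h2
    · exact htop
    · exact ih (le_trans (by exact_mod_cast n.le_succ) hn)
        (fun j h1 h2 => hA j h1 (by omega)) (fun j h1 h2 => hB j h1 (by omega)) h j h1 (by omega)

lemma rep_unique (i n : ℕ) (hn : (n : ℕ∞) ≤ d.len) {A B C D : ℕ → ℤ}
    (hA : PermZ d.q n A) (hB : PermZ d.q n B) (hC : PermZ d.s i C) (hD : PermZ d.s i D)
    (h : wtZ d.β n A + wtZ d.γ i C = wtZ d.β n B + wtZ d.γ i D) :
    (∀ j, 1 ≤ j → j ≤ n → A j = B j) ∧ ∀ j, 1 ≤ j → j ≤ i → C j = D j := by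
  induction i with
  | zero =>
    rw [wtZ_zero, wtZ_zero, add_left_inj] at h
    exact ⟨d.rep_Gr_unique n hn hA hB h, by omega⟩
  | succ i ih =>
    rw [wtZ_succ, wtZ_succ] at h
    have hgr (A C : ℕ → ℤ) :
        wtZ d.β n A + wtZ d.γ i C ∈ grSubgroup d.β n ⊔ grSubgroup d.γ i :=
      mem_GrH_iff.1 ⟨_, wtZ_mem_Gr _ _ _, _, wtZ_mem_Gr _ _ _, rfl⟩
    have htop : C (i + 1) = D (i + 1) := by
      refine eq_of_sub_mul_mem (K := grSubgroup d.β n ⊔ grSubgroup d.γ i)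
        (fun t ht hm => have hm' := mem_GrH_iff.2 hm; d.s_le (by omega) ht ⟨n, hn, hm'⟩)
        (hC (i + 1) (by omega) le_rfl) (hD (i + 1) (by omega) le_rfl) ?_
      have := sub_mem (hgr B D) (hgr A C)
      convert this using 1
      push_cast
      linarith
    rw [htop, ← add_assoc, ← add_assoc, add_left_inj] at h
    obtain ⟨h₁, h₂⟩ := ih (fun j h1 h2 => hC j h1 (by omega))
      (fun j h1 h2 => hD j h1 (by omega)) h
    refine ⟨h₁, fun j h1 h2 => ?_⟩
    rcases h2.eq_or_lt with rfl | h2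
    · exact htop
    · exact h₂ j h1 (by omega)

end Setup

lemma SuppZ.ext {n : ℕ} {A B : ℕ → ℤ} (hA : SuppZ n A) (hB : SuppZ n B)
    (h : ∀ j, 1 ≤ j → j ≤ n → A j = B j) : A = B := by
  funext j
  by_cases hj : j = 0 ∨ n < j
  · rw [hA j hj, hB j hj]
  · exact h j (by omega) (by omega)

/-- Lemma: group representation. If `α ∈ G_k + H_i` and `m = max(k, m_i)`,
then there is a unique permissible coefficient vector `(L, N) ∈ ℤ^m × ℤ^i`
with `α = |(L, N)|`. -/
theorem group_representation (d : Setup) (k i : ℕ) (hk : 1 ≤ k)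
    (hkl : (k : ℕ∞) ≤ d.len) (α : ℝ) (hα : α ∈ GrH d.β d.γ k i) :
    ∃! LN : (ℕ → ℤ) × (ℕ → ℤ),
      SuppZ (max k (d.m i)) LN.1 ∧ SuppZ i LN.2 ∧
      PermZ d.q (max k (d.m i)) LN.1 ∧ PermZ d.s i LN.2 ∧
      α = wtZ d.β (max k (d.m i)) LN.1 + wtZ d.γ i LN.2 := by
  obtain ⟨L, N, hL, hN, hPL, hPN, hE⟩ := d.exists_rep i k hk hkl α hα
  refine ⟨(L, N), ⟨hL, hN, hPL, hPN, hE⟩, ?_⟩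
  rintro ⟨L', N'⟩ ⟨hL', hN', hPL', hPN', hE'⟩
  have hmax : ((max k (d.m i) : ℕ) : ℕ∞) ≤ d.len := by
    rcases max_choice k (d.m i) with h | h <;> rw [h]
    · exact hkl
    · exact (d.hmlen _).2
  obtain ⟨h₁, h₂⟩ := d.rep_unique i _ hmax hPL' hPL hPN' hPN (hE'.symm.trans hE)
  exact Prod.ext (hL'.ext hL h₁) (hN'.ext hN h₂)

end Jump
end

section
/- Suppose k ≥ 2 and q_t < ∞ for all 2 ≤ t ≤ k. If A ∈ ℤ^k is a permissible vector, then Σ_{t=2}^k a_tβ_t < q_kβ_k. -/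
namespace Jump

/-- If `q_t < ∞` for `2 ≤ t ≤ k` and `A ∈ ℤ^k` is permissible,
then `Σ_{t=2}^k a_tβ_t < q_kβ_k`. -/
theorem permissible_sum_lt (d : Setup) (k : ℕ) (hk : 2 ≤ k) (hkl : (k : ℕ∞) ≤ d.len)
    (hqfin : ∀ t : ℕ, 2 ≤ t → t ≤ k → d.q t ≠ ⊤)
    (A : ℕ → ℤ) (hA : PermZ d.q k A) (qk : ℕ) (hqk : d.q k = (qk : ℕ∞)) :
    (∑ t ∈ Finset.Icc 2 k, (A t : ℝ) * d.β t) < (qk : ℝ) * d.β k := by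
  induction k, hk using Nat.le_induction generalizing qk with
  | base =>
    have hlt : (A 2 : ℝ) < qk := by exact_mod_cast (hA 2 (by norm_num) le_rfl qk hqk).2
    simpa using mul_lt_mul_of_pos_right hlt (d.hβ 2 (by norm_num) hkl)
  | succ k hk ih =>
    have hkl' : (k : ℕ∞) ≤ d.len := le_trans (by exact_mod_cast Nat.le_succ k) hkl
    obtain ⟨r, hr⟩ := ENat.ne_top_iff_exists.mp (hqfin k hk (Nat.le_succ k))
    have hsum := ih hkl' (fun t h2 ht => hqfin t h2 (ht.trans (Nat.le_succ k)))
      (fun j h1 hj => hA j h1 (hj.trans (Nat.le_succ k))) r hr.symm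
    have hgrow := d.hgrow k hk hkl' r hr.symm
    have hpos := d.hβ (k + 1) (by omega) hkl
    have hle : (A (k + 1) : ℝ) + 1 ≤ qk := by
      exact_mod_cast Int.add_one_le_iff.mpr (hA (k + 1) (by omega) le_rfl qk hqk).2
    rw [Finset.sum_Icc_succ_top (by omega)]
    linarith [mul_le_mul_of_nonneg_right hle hpos.le]

end Jump
end

section
/- Let 𝐤 be a field, let q_2, q_3, … be positive integers, for each j ≥ 2 let λ_j ∈ 𝐤, and let L(j) = (l_1(j), …, l_{j−1}(j)) ∈ ℕ₀^{j−1} satisfy l_t(j) < q_t for all 2 ≤ t ≤ j−1. Define P_1 = x, P_2 = y in 𝐤[x, y] and, recursively, P_{j+1} = P_j^{q_j} − λ_j ∏_{t=1}^{j−1} P_t^{l_t(j)} for j ≥ 2. Then for every j ≥ 2, P_j, regarded as a polynomial in y with coefficients in 𝐤[x], is a nonzero monic polynomial of y-degree ∏_{t=2}^{j−1} q_t (the empty product, i.e. degree 1, when j = 2). -/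
/-- A mixed-radix estimate: if `P 1` is constant, `P t` has degree at most `∏_{s=2}^{t-1} q_s`, and
`l t < q t` for `2 ≤ t ≤ m`, then `∏_{t=1}^m P_t^{l_t}` has degree less than `∏_{t=2}^m q_t`. -/
theorem Polynomial.natDegree_prod_pow_lt_prod {R : Type*} [CommSemiring R]
    (q l : ℕ → ℕ) (P : ℕ → Polynomial R) (hP1 : (P 1).natDegree = 0) {m : ℕ} (hm : 1 ≤ m)
    (hl : ∀ t, 2 ≤ t → t ≤ m → l t < q t)
    (hP : ∀ t, 2 ≤ t → t ≤ m → (P t).natDegree ≤ ∏ s ∈ Finset.Icc 2 (t - 1), q s) :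
    (∏ t ∈ Finset.Icc 1 m, P t ^ l t).natDegree < ∏ t ∈ Finset.Icc 2 m, q t := by
  induction m, hm using Nat.le_induction with
  | base =>
    have h : (P 1 ^ l 1).natDegree ≤ l 1 * (P 1).natDegree := Polynomial.natDegree_pow_le
    rw [hP1, mul_zero] at h
    simpa using h
  | succ m hm ih =>
    have hprod := ih (fun t h2 ht => hl t h2 (by lia)) (fun t h2 ht => hP t h2 (by lia))
    have hdeg := hP (m + 1) (by lia) le_rfl
    rw [Nat.add_sub_cancel] at hdeg
    rw [Finset.prod_Icc_succ_top (by lia), Finset.prod_Icc_succ_top (by lia)]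
    set D := ∏ t ∈ Finset.Icc 2 m, q t
    calc _ ≤ (∏ t ∈ Finset.Icc 1 m, P t ^ l t).natDegree + (P (m + 1) ^ l (m + 1)).natDegree :=
          Polynomial.natDegree_mul_le
      _ ≤ (∏ t ∈ Finset.Icc 1 m, P t ^ l t).natDegree + l (m + 1) * D := by
          gcongr
          exact Polynomial.natDegree_pow_le.trans (Nat.mul_le_mul_left _ hdeg)
      _ < D + l (m + 1) * D := by gcongr
      _ = D * (l (m + 1) + 1) := by ring
      _ ≤ D * q (m + 1) := Nat.mul_le_mul_left _ (hl (m + 1) (by lia) le_rfl)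

/-- Let `q_j` be positive integers (`j ≥ 2`), `λ_j ∈ 𝕜`, and
`L(j) ∈ ℕ₀^{j-1}` with `L(j)_t < q_t` for `2 ≤ t ≤ j - 1`. Define `P_1 = x`, `P_2 = y`
in `𝕜[x][y]` and `P_{j+1} = P_j^{q_j} - λ_j ∏_t P_t^{L(j)_t}`. Then every `P_j` (`j ≥ 2`),
as a polynomial in `y` over `𝕜[x]`, is nonzero, monic, of degree `∏_{t=2}^{j-1} q_t`. -/
theorem jumping_polynomials_monic {𝕜 : Type} [Field 𝕜]
    (q : ℕ → ℕ) (lam : ℕ → 𝕜) (L : ℕ → ℕ → ℕ)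
    (hq : ∀ j : ℕ, 2 ≤ j → 0 < q j)
    (hLlt : ∀ j : ℕ, 2 ≤ j → ∀ t : ℕ, 2 ≤ t → t ≤ j - 1 → L j t < q t)
    (hLsupp : ∀ j : ℕ, 2 ≤ j → ∀ t : ℕ, (t = 0 ∨ j - 1 < t) → L j t = 0)
    (P : ℕ → Polynomial (Polynomial 𝕜))
    (hP1 : P 1 = Polynomial.C Polynomial.X)
    (hP2 : P 2 = Polynomial.X)
    (hPrec : ∀ j : ℕ, 2 ≤ j →
      P (j + 1) = P j ^ q j -
        Polynomial.C (Polynomial.C (lam j)) * ∏ t ∈ Finset.Icc 1 (j - 1), P t ^ L j t) :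
    ∀ j : ℕ, 2 ≤ j → P j ≠ 0 ∧ (P j).Monic ∧
      (P j).natDegree = ∏ t ∈ Finset.Icc 2 (j - 1), q t := by
  suffices h : ∀ j : ℕ, 2 ≤ j →
      (P j).Monic ∧ (P j).natDegree = ∏ t ∈ Finset.Icc 2 (j - 1), q t from
    fun j hj => ⟨(h j hj).1.ne_zero, h j hj⟩
  intro j
  induction j using Nat.strong_induction_on with
  | _ j ih =>
    intro hj
    obtain rfl | hj3 := hj.eq_or_lt
    · simp [hP2, Polynomial.monic_X]
    obtain ⟨n, rfl⟩ : ∃ n, j = n + 1 := ⟨j - 1, by lia⟩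
    have hn : 2 ≤ n := by lia
    obtain ⟨hmonic, hdeg⟩ := ih n (by lia) hn
    have hlt : (∏ t ∈ Finset.Icc 1 (n - 1), P t ^ L n t).natDegree <
        ∏ t ∈ Finset.Icc 2 (n - 1), q t :=
      Polynomial.natDegree_prod_pow_lt_prod q (L n) P (by simp [hP1]) (by lia) (hLlt n hn)
        fun t h2 ht => (ih t (by lia) h2).2.le
    have hpow : (P n ^ q n).natDegree = (∏ t ∈ Finset.Icc 2 (n - 1), q t) * q n := by
      rw [hmonic.natDegree_pow, hdeg, mul_comm]
    have hsub : (Polynomial.C (Polynomial.C (lam n)) *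
        ∏ t ∈ Finset.Icc 1 (n - 1), P t ^ L n t).natDegree < (P n ^ q n).natDegree := by
      rw [hpow]
      exact (Polynomial.natDegree_C_mul_le _ _).trans_lt
        (hlt.trans_le (Nat.le_mul_of_pos_right _ (hq n hn)))
    rw [hPrec n hn]
    refine ⟨(hmonic.pow _).sub_of_left (Polynomial.degree_lt_degree hsub), ?_⟩
    rw [Polynomial.natDegree_sub_eq_left_of_natDegree_lt hsub, hpow, Nat.add_sub_cancel]
    obtain ⟨k, rfl⟩ : ∃ k, n = k + 1 := ⟨n - 1, by lia⟩
    rw [Finset.prod_Icc_succ_top (by lia), Nat.add_sub_cancel]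
end

section
/- The seven elements x, y, z, xz − y², x³z − x²y² − yz², x²yz − xy³ − z³, and −x⁵z² + 2x⁴y²z − x³y⁴ + 2x²yz³ − 2xy³z² − z⁵ of R form a minimal generating sequence of ν in R: for every σ ∈ ν(R∖{0}), the ideal I_σ = {f ∈ R : ν(f) ≥ σ} is generated by the finite products of powers of these seven elements whose ν-value is at least σ, and no proper subset of these seven elements has this property. -/
/-! The example of section 5: the monomial valuation with `ν(x) = 1`, `ν(y) = √2`,
`ν(z′) = √51 − 5` on `𝐤(x, y, z′)`. -/

namespace JumpExample

/-- The rational function field `K = 𝕜(x, y, z′)` in three variables. -/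
abbrev Kex (𝕜 : Type) [Field 𝕜] : Type := FractionRing (MvPolynomial (Fin 3) 𝕜)

/-- The embedding of the polynomial ring into `K`. -/
noncomputable def emb (𝕜 : Type) [Field 𝕜] : MvPolynomial (Fin 3) 𝕜 →+* Kex 𝕜 :=
  algebraMap (MvPolynomial (Fin 3) 𝕜) (Kex 𝕜)

/-- The variables `x`, `y`, `z′` of `K`. -/
noncomputable def xv (𝕜 : Type) [Field 𝕜] : Kex 𝕜 := emb 𝕜 (MvPolynomial.X 0)
noncomputable def yv (𝕜 : Type) [Field 𝕜] : Kex 𝕜 := emb 𝕜 (MvPolynomial.X 1)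
noncomputable def z'v (𝕜 : Type) [Field 𝕜] : Kex 𝕜 := emb 𝕜 (MvPolynomial.X 2)

/-- The weight `a + b√2 + c(√51 − 5)` of a monomial `x^a y^b z′^c`. -/
noncomputable def wdeg (dd : Fin 3 →₀ ℕ) : ℝ :=
  (dd 0 : ℝ) + (dd 1 : ℝ) * Real.sqrt 2 + (dd 2 : ℝ) * (Real.sqrt 51 - 5)

/-- The hypotheses on `ν`: a rank 1 valuation on `K`, trivial on `𝕜`, which is the
monomial valuation with `ν(x) = 1`, `ν(y) = √2`, `ν(z′) = √51 − 5`. -/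
structure IsMonomialValuation (𝕜 : Type) [Field 𝕜] (ν : Kex 𝕜 → ℝ) : Prop where
  hmul : ∀ f g : Kex 𝕜, f ≠ 0 → g ≠ 0 → ν (f * g) = ν f + ν g
  hadd : ∀ f g : Kex 𝕜, f ≠ 0 → g ≠ 0 → f + g ≠ 0 → min (ν f) (ν g) ≤ ν (f + g)
  htriv : ∀ c : 𝕜, c ≠ 0 → ν (emb 𝕜 (MvPolynomial.C c)) = 0
  hmono : ∀ p : MvPolynomial (Fin 3) 𝕜, p ≠ 0 →
    ν (emb 𝕜 p) = sInf {t : ℝ | ∃ dd ∈ p.support, t = wdeg dd}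

/-- The element `z = y²/x + y⁵/x⁵ + z′` of `K`. -/
noncomputable def zel (𝕜 : Type) [Field 𝕜] : Kex 𝕜 :=
  yv 𝕜 ^ 2 / xv 𝕜 + yv 𝕜 ^ 5 / xv 𝕜 ^ 5 + z'v 𝕜

/-- The evaluation map `𝕜[X₀, X₁, X₂] → K` sending `X₀ ↦ x`, `X₁ ↦ y`, `X₂ ↦ z`. -/
noncomputable def evz (𝕜 : Type) [Field 𝕜] : MvPolynomial (Fin 3) 𝕜 →+* Kex 𝕜 :=
  MvPolynomial.eval₂Hom ((emb 𝕜).comp (MvPolynomial.C : 𝕜 →+* MvPolynomial (Fin 3) 𝕜))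
    (fun i => if i = 0 then xv 𝕜 else if i = 1 then yv 𝕜 else zel 𝕜)

/-- The local ring `R = 𝕜[x, y, z]_{(x, y, z)}`, as a subset of `K`: quotients `p/q` of
polynomial expressions in `x, y, z` over `𝕜` where `q` has nonzero constant term. -/
noncomputable def Rloc (𝕜 : Type) [Field 𝕜] : Set (Kex 𝕜) :=
  {f | ∃ p q : MvPolynomial (Fin 3) 𝕜, MvPolynomial.coeff 0 q ≠ 0 ∧ f = evz 𝕜 p / evz 𝕜 q}

end JumpExample

namespace JumpExample

/-- The seven elements `x, y, z, xz − y², x³z − x²y² − yz², x²yz − xy³ − z³,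
−x⁵z² + 2x⁴y²z − x³y⁴ + 2x²yz³ − 2xy³z² − z⁵` of `R`. -/
noncomputable def Qgen (𝕜 : Type) [Field 𝕜] : Fin 7 → Kex 𝕜 :=
  fun e =>
    letI x := xv 𝕜; letI y := yv 𝕜; letI z := zel 𝕜
    match e with
    | 0 => x
    | 1 => y
    | 2 => z
    | 3 => x * z - y ^ 2
    | 4 => x ^ 3 * z - x ^ 2 * y ^ 2 - y * z ^ 2
    | 5 => x ^ 2 * y * z - x * y ^ 3 - z ^ 3
    | 6 => -(x ^ 5 * z ^ 2) + 2 * x ^ 4 * y ^ 2 * z - x ^ 3 * y ^ 4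
          + 2 * x ^ 2 * y * z ^ 3 - 2 * x * y ^ 3 * z ^ 2 - z ^ 5

/-- A subfamily (indexed by `s ⊆ Fin 7`) of the seven elements is a generating sequence of
`ν` in `R` if for every `σ` in the value semigroup `ν(R∖{0})`, the valuation ideal
`I_σ = {f ∈ R : ν(f) ≥ σ}` equals the set of finite `R`-linear combinations of products
`∏ Q_ℓ^{b_ℓ}` (with `b` supported on `s`) of value at least `σ`. -/
def IsGenSeqOn (𝕜 : Type) [Field 𝕜] (ν : Kex 𝕜 → ℝ) (s : Set (Fin 7)) : Prop :=
  ∀ σ : ℝ, (∃ f, f ∈ Rloc 𝕜 ∧ f ≠ 0 ∧ ν f = σ) →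
    {f | f ∈ Rloc 𝕜 ∧ (f = 0 ∨ σ ≤ ν f)} =
    {f | ∃ (M : ℕ) (g : Fin M → Kex 𝕜) (b : Fin M → Fin 7 → ℕ),
      (∀ e, g e ∈ Rloc 𝕜) ∧ (∀ e ℓ, b e ℓ ≠ 0 → ℓ ∈ s) ∧
      (∀ e, σ ≤ ∑ ℓ, (b e ℓ : ℝ) * ν (Qgen 𝕜 ℓ)) ∧
      f = ∑ e, g e * ∏ ℓ, Qgen 𝕜 ℓ ^ b e ℓ}

section Valuation

variable {K : Type*} [Field K]

/-- A real-valued additive valuation on a field, with no condition on the value at `0`. -/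
structure IsAddValuation (ν : K → ℝ) : Prop where
  map_mul : ∀ f g : K, f ≠ 0 → g ≠ 0 → ν (f * g) = ν f + ν g
  map_add : ∀ f g : K, f ≠ 0 → g ≠ 0 → f + g ≠ 0 → min (ν f) (ν g) ≤ ν (f + g)

/-- `f` is nonzero of value `t`. -/
def HasVal (ν : K → ℝ) (t : ℝ) (f : K) : Prop := f ≠ 0 ∧ ν f = t

/-- `f` has value at least `t`, where `0` has value `∞`. -/
def AtLeast (ν : K → ℝ) (t : ℝ) (f : K) : Prop := f = 0 ∨ t ≤ ν f

/-- `f` has value more than `t`, where `0` has value `∞`. -/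
def MoreThan (ν : K → ℝ) (t : ℝ) (f : K) : Prop := f = 0 ∨ t < ν f

variable {ν : K → ℝ}

theorem HasVal.atLeast {t : ℝ} {f : K} (h : HasVal ν t f) : AtLeast ν t f := Or.inr h.2.ge

theorem AtLeast.mono {s t : ℝ} {f : K} (h : AtLeast ν t f) (hst : s ≤ t) : AtLeast ν s f :=
  h.imp_right hst.trans

theorem AtLeast.moreThan {s t : ℝ} {f : K} (h : AtLeast ν t f) (hst : s < t) : MoreThan ν s f :=
  h.imp_right hst.trans_le

namespace IsAddValuation

theorem map_one (hν : IsAddValuation ν) : ν 1 = 0 := by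
  have := hν.map_mul 1 1 one_ne_zero one_ne_zero
  simp only [mul_one] at this
  linarith

theorem map_neg_one (hν : IsAddValuation ν) : ν (-1) = 0 := by
  have := hν.map_mul (-1) (-1) (by simp) (by simp)
  simp only [mul_neg, mul_one, neg_neg, hν.map_one] at this
  linarith

theorem map_neg (hν : IsAddValuation ν) (f : K) : ν (-f) = ν f := by
  rcases eq_or_ne f 0 with rfl | hf
  · simp
  · rw [← neg_one_mul, hν.map_mul _ _ (by simp) hf, hν.map_neg_one, zero_add]

theorem hasVal_one (hν : IsAddValuation ν) : HasVal ν 0 1 := ⟨one_ne_zero, hν.map_one⟩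

theorem hasVal_mul (hν : IsAddValuation ν) {s t : ℝ} {f g : K} (hf : HasVal ν s f)
    (hg : HasVal ν t g) : HasVal ν (s + t) (f * g) :=
  ⟨mul_ne_zero hf.1 hg.1, by rw [hν.map_mul _ _ hf.1 hg.1, hf.2, hg.2]⟩

theorem hasVal_pow (hν : IsAddValuation ν) {t : ℝ} {f : K} (hf : HasVal ν t f) (n : ℕ) :
    HasVal ν (n * t) (f ^ n) := by
  induction n with
  | zero => simpa using hν.hasVal_one
  | succ n ih =>
    rw [pow_succ]
    convert hν.hasVal_mul ih hf using 1
    push_cast; ring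

theorem hasVal_div (hν : IsAddValuation ν) {s t : ℝ} {f g : K} (hf : HasVal ν s f)
    (hg : HasVal ν t g) : HasVal ν (s - t) (f / g) := by
  have hne : f / g ≠ 0 := div_ne_zero hf.1 hg.1
  refine ⟨hne, ?_⟩
  have := hν.map_mul _ _ hne hg.1
  rw [div_mul_cancel₀ _ hg.1, hf.2, hg.2] at this
  linarith

theorem hasVal_prod (hν : IsAddValuation ν) {ι : Type*} (S : Finset ι) {t : ι → ℝ} {f : ι → K}
    (h : ∀ i ∈ S, HasVal ν (t i) (f i)) : HasVal ν (∑ i ∈ S, t i) (∏ i ∈ S, f i) := by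
  classical
  induction S using Finset.induction_on with
  | empty => simpa using hν.hasVal_one
  | insert i S hi ih =>
    rw [Finset.sum_insert hi, Finset.prod_insert hi]
    exact hν.hasVal_mul (h i (by simp)) (ih fun j hj => h j (by simp [hj]))

theorem atLeast_add (hν : IsAddValuation ν) {t : ℝ} {f g : K} (hf : AtLeast ν t f)
    (hg : AtLeast ν t g) : AtLeast ν t (f + g) := by
  by_cases h0 : f = 0
  · rwa [h0, zero_add]
  by_cases h1 : g = 0
  · rwa [h1, add_zero]
  by_cases h2 : f + g = 0
  · exact Or.inl h2
  · exact Or.inr ((le_min (hf.resolve_left h0) (hg.resolve_left h1)).trans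
      (hν.map_add _ _ h0 h1 h2))

theorem moreThan_add (hν : IsAddValuation ν) {t : ℝ} {f g : K} (hf : MoreThan ν t f)
    (hg : MoreThan ν t g) : MoreThan ν t (f + g) := by
  by_cases h0 : f = 0
  · rwa [h0, zero_add]
  by_cases h1 : g = 0
  · rwa [h1, add_zero]
  by_cases h2 : f + g = 0
  · exact Or.inl h2
  · exact Or.inr ((lt_min (hf.resolve_left h0) (hg.resolve_left h1)).trans_le
      (hν.map_add _ _ h0 h1 h2))

theorem atLeast_sum (hν : IsAddValuation ν) {ι : Type*} (S : Finset ι) {t : ℝ} {f : ι → K}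
    (h : ∀ i ∈ S, AtLeast ν t (f i)) : AtLeast ν t (∑ i ∈ S, f i) :=
  Finset.sum_induction _ _ (fun _ _ => hν.atLeast_add) (Or.inl rfl) h

theorem moreThan_sum (hν : IsAddValuation ν) {ι : Type*} (S : Finset ι) {t : ℝ} {f : ι → K}
    (h : ∀ i ∈ S, MoreThan ν t (f i)) : MoreThan ν t (∑ i ∈ S, f i) :=
  Finset.sum_induction _ _ (fun _ _ => hν.moreThan_add) (Or.inl rfl) h

theorem atLeast_mul (hν : IsAddValuation ν) {s t : ℝ} {f g : K} (hf : AtLeast ν s f)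
    (hg : AtLeast ν t g) : AtLeast ν (s + t) (f * g) := by
  by_cases h0 : f = 0
  · exact Or.inl (by simp [h0])
  by_cases h1 : g = 0
  · exact Or.inl (by simp [h1])
  · right
    rw [hν.map_mul _ _ h0 h1]
    exact add_le_add (hf.resolve_left h0) (hg.resolve_left h1)

theorem atLeast_pow (hν : IsAddValuation ν) {t : ℝ} {f : K} (hf : AtLeast ν t f) (n : ℕ) :
    AtLeast ν (n * t) (f ^ n) := by
  induction n with
  | zero => simpa using hν.hasVal_one.atLeast
  | succ n ih =>
    rw [pow_succ]
    convert hν.atLeast_mul ih hf using 1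
    push_cast; ring

theorem atLeast_neg (hν : IsAddValuation ν) {t : ℝ} {f : K} (hf : AtLeast ν t f) :
    AtLeast ν t (-f) := by
  simpa [AtLeast, hν.map_neg] using hf

theorem atLeast_natCast_mul (hν : IsAddValuation ν) {t : ℝ} (n : ℕ) {f : K}
    (hf : AtLeast ν t f) : AtLeast ν t (n * f) := by
  induction n with
  | zero => exact Or.inl (by simp)
  | succ n ih =>
    rw [Nat.cast_succ, add_mul, one_mul]
    exact hν.atLeast_add ih hf

theorem hasVal_add (hν : IsAddValuation ν) {t : ℝ} {f g : K} (hf : HasVal ν t f)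
    (hg : MoreThan ν t g) : HasVal ν t (f + g) := by
  obtain ⟨hf0, rfl⟩ := hf
  by_cases h1 : g = 0
  · rw [h1, add_zero]; exact ⟨hf0, rfl⟩
  have hlt := hg.resolve_left h1
  have h2 : f + g ≠ 0 := by
    intro h
    rw [← neg_eq_of_add_eq_zero_right h, hν.map_neg] at hlt
    exact lt_irrefl _ hlt
  refine ⟨h2, le_antisymm ?_ ?_⟩
  · have := hν.map_add (f + g) (-g) h2 (neg_ne_zero.2 h1) (by simpa using hf0)
    rw [hν.map_neg, add_neg_cancel_right] at this
    rcases min_le_iff.1 this with h | h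
    · exact h
    · exact absurd h (not_le.2 hlt)
  · have := hν.map_add f g hf0 h1 h2
    rwa [min_eq_left hlt.le] at this

/-- A sum of nonzero terms of pairwise distinct values has the value of its smallest term. -/
theorem le_of_atLeast_sum (hν : IsAddValuation ν) {ι : Type*} (S : Finset ι) {f : ι → K}
    (hf : ∀ i ∈ S, f i ≠ 0) (hinj : Set.InjOn (fun i => ν (f i)) S) {σ : ℝ}
    (h : AtLeast ν σ (∑ i ∈ S, f i)) : ∀ i ∈ S, σ ≤ ν (f i) := by
  classical
  intro i hi
  obtain ⟨j, hj, hmin⟩ := S.exists_min_image (fun i => ν (f i)) ⟨i, hi⟩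
  have hval : HasVal ν (ν (f j)) (∑ i ∈ S, f i) := by
    rw [← Finset.add_sum_erase S f hj]
    refine hν.hasVal_add ⟨hf j hj, rfl⟩ (hν.moreThan_sum _ fun k hk => Or.inr ?_)
    have hkS := Finset.mem_of_mem_erase hk
    refine lt_of_le_of_ne (hmin k hkS) fun he => Finset.ne_of_mem_erase hk ?_
    exact (hinj hj hkS he).symm
  rcases h with h | h
  · exact absurd h hval.1
  · exact (h.trans hval.2.le).trans (hmin i hi)

end IsAddValuation

end Valuation

theorem eq_zero_of_add_sqrt_two_add_sqrt_fiftyOne {a b c : ℤ}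
    (h : (a : ℝ) + b * Real.sqrt 2 + c * Real.sqrt 51 = 0) : a = 0 ∧ b = 0 ∧ c = 0 := by
  have h2 : Real.sqrt 2 ^ 2 = 2 := Real.sq_sqrt (by norm_num)
  have h51 : Real.sqrt 51 ^ 2 = 51 := Real.sq_sqrt (by norm_num)
  have irr {r : ℝ} (hr : Irrational r) {m n : ℤ} (hmn : (m : ℝ) + n * r = 0) :
      m = 0 ∧ n = 0 := by
    have hn : n = 0 := by
      by_contra hn
      exact ((hr.intCast_mul hn).intCast_add m).ne_zero hmn
    subst hn
    simpa using hmn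
  have i2 : Irrational (Real.sqrt 2) := irrational_sqrt_two
  have i51 : Irrational (Real.sqrt 51) := by
    rw [irrational_sqrt_ofNat_iff]; norm_num
  have i102 : Irrational (Real.sqrt 102) := by
    rw [irrational_sqrt_ofNat_iff]; norm_num
  have hsq : ((a ^ 2 + 2 * b ^ 2 - 51 * c ^ 2 : ℤ) : ℝ) + ((2 * a * b : ℤ) : ℝ) * Real.sqrt 2
      = 0 := by
    push_cast
    linear_combination (a + b * Real.sqrt 2 - c * Real.sqrt 51) * h - (b : ℝ) ^ 2 * h2
      + (c : ℝ) ^ 2 * h51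
  have hab := (irr i2 hsq).2
  rcases eq_or_ne b 0 with rfl | hb
  · obtain ⟨ha, hc⟩ := irr i51 (m := a) (n := c) (by simpa using h)
    exact ⟨ha, rfl, hc⟩
  · have ha : a = 0 := by simpa [hb] using hab
    subst ha
    have h102 : Real.sqrt 102 = Real.sqrt 2 * Real.sqrt 51 := by
      rw [← Real.sqrt_mul (by norm_num)]; norm_num
    have hlin : ((2 * b : ℤ) : ℝ) + (c : ℝ) * Real.sqrt 102 = 0 := by
      rw [h102]
      push_cast at h ⊢
      linear_combination Real.sqrt 2 * h - b * h2
    have := (irr i102 hlin).1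
    omega

/-- The exponents in `x, y, z′` of the initial monomials of the seven generators. -/
def initExp : Fin 7 → Fin 3 → ℤ :=
  ![![1, 0, 0], ![0, 1, 0], ![-1, 2, 0], ![-4, 5, 0], ![3, 0, 1], ![2, 1, 1], ![5, 0, 2]]

/-- The value of a Laurent monomial in `x, y, z′`. -/
noncomputable def weight (m : Fin 3 → ℤ) : ℝ :=
  m 0 + m 1 * Real.sqrt 2 + m 2 * (Real.sqrt 51 - 5)

theorem weight_injective : Function.Injective weight := by
  intro m n h
  unfold weight at h
  obtain ⟨h0, h1, h2⟩ := eq_zero_of_add_sqrt_two_add_sqrt_fiftyOne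
    (a := m 0 - n 0 - 5 * (m 2 - n 2)) (b := m 1 - n 1) (c := m 2 - n 2)
    (by push_cast; linear_combination h)
  funext i
  fin_cases i <;> simp only [Fin.zero_eta, Fin.mk_one, Fin.reduceFinMk] <;> omega

theorem sum_mul_weight (b : Fin 7 → ℕ) :
    ∑ ℓ, (b ℓ : ℝ) * weight (initExp ℓ) = weight (fun i => ∑ ℓ, b ℓ * initExp ℓ i) := by
  simp only [weight, Int.cast_sum, Int.cast_mul, Int.cast_natCast, Finset.sum_mul,
    ← Finset.sum_add_distrib]
  exact Finset.sum_congr rfl fun ℓ _ => by ring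

section Values

variable {𝕜 : Type} [Field 𝕜] {ν : Kex 𝕜 → ℝ}

theorem IsMonomialValuation.isAddValuation (hν : IsMonomialValuation 𝕜 ν) :
    IsAddValuation ν := ⟨hν.hmul, hν.hadd⟩

theorem emb_injective : Function.Injective (emb 𝕜) :=
  IsFractionRing.injective (MvPolynomial (Fin 3) 𝕜) (Kex 𝕜)

theorem IsMonomialValuation.hasVal_X (hν : IsMonomialValuation 𝕜 ν) (i : Fin 3) :
    HasVal ν (wdeg (Finsupp.single i 1)) (emb 𝕜 (MvPolynomial.X i)) := by
  have h0 : (MvPolynomial.X i : MvPolynomial (Fin 3) 𝕜) ≠ 0 := MvPolynomial.X_ne_zero i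
  refine ⟨(map_ne_zero_iff _ emb_injective).2 h0, ?_⟩
  rw [hν.hmono _ h0, MvPolynomial.support_X]
  simp

theorem IsMonomialValuation.hasVal_x (hν : IsMonomialValuation 𝕜 ν) : HasVal ν 1 (xv 𝕜) := by
  simpa [wdeg, xv] using hν.hasVal_X 0

theorem IsMonomialValuation.hasVal_y (hν : IsMonomialValuation 𝕜 ν) :
    HasVal ν (Real.sqrt 2) (yv 𝕜) := by
  simpa [wdeg, yv] using hν.hasVal_X 1

theorem IsMonomialValuation.hasVal_z' (hν : IsMonomialValuation 𝕜 ν) :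
    HasVal ν (Real.sqrt 51 - 5) (z'v 𝕜) := by
  simpa [wdeg, z'v] using hν.hasVal_X 2

theorem sqrt_two_bounds : 1.4142 < Real.sqrt 2 ∧ Real.sqrt 2 < 1.4143 :=
  ⟨Real.lt_sqrt_of_sq_lt (by norm_num), (Real.sqrt_lt' (by norm_num)).2 (by norm_num)⟩

theorem sqrt_fiftyOne_bounds : 7.1414 < Real.sqrt 51 ∧ Real.sqrt 51 < 7.1415 :=
  ⟨Real.lt_sqrt_of_sq_lt (by norm_num), (Real.sqrt_lt' (by norm_num)).2 (by norm_num)⟩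

theorem IsMonomialValuation.hasVal_Qgen (hν : IsMonomialValuation 𝕜 ν) (ℓ : Fin 7) :
    HasVal ν (weight (initExp ℓ)) (Qgen 𝕜 ℓ) := by
  obtain ⟨l2, u2⟩ := sqrt_two_bounds
  obtain ⟨l51, u51⟩ := sqrt_fiftyOne_bounds
  have V := hν.isAddValuation
  have hx := hν.hasVal_x
  have hy := hν.hasVal_y
  have hc := hν.hasVal_z'
  have hA := V.hasVal_div (V.hasVal_pow hy 2) hx
  have hB := V.hasVal_div (V.hasVal_pow hy 5) (V.hasVal_pow hx 5)
  have hδ := V.hasVal_add hB (hc.atLeast.moreThan (by push_cast; linarith))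
  have hz := V.hasVal_add hA (hδ.atLeast.moreThan (by push_cast; linarith))
  have hx0 := hx.1
  simp only [Qgen, zel]
  generalize xv 𝕜 = x at *
  generalize yv 𝕜 = y at *
  generalize z'v 𝕜 = c at *
  have hxA : x * (y ^ 2 / x) = y ^ 2 := by field_simp
  have hBA : x ^ 3 * (y ^ 5 / x ^ 5) = y * (y ^ 2 / x) ^ 2 := by field_simp
  have hBA' : x ^ 2 * y * (y ^ 5 / x ^ 5) = (y ^ 2 / x) ^ 3 := by field_simp
  have hBA'' : x ^ 5 * (y ^ 5 / x ^ 5) ^ 2 = (y ^ 2 / x) ^ 5 := by field_simp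
  rw [add_assoc]
  generalize y ^ 2 / x = A at *
  generalize y ^ 5 / x ^ 5 = B at *
  generalize hδdef : B + c = δ at *
  obtain rfl : B = δ - c := by rw [← hδdef]; ring
  have hδA := hδ.atLeast.mono
    (show ((2 : ℕ) : ℝ) * Real.sqrt 2 - 1 ≤ _ by push_cast; linarith)
  have hlin : AtLeast ν (((2 : ℕ) : ℝ) * Real.sqrt 2 - 1) (((2 : ℕ) : Kex 𝕜) * A + δ) :=
    V.atLeast_add (V.atLeast_natCast_mul 2 hA.atLeast) hδA
  push_cast at hA hδ hz hδA hlin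
  fin_cases ℓ <;>
    simp only [weight, initExp, Fin.zero_eta, Fin.mk_one, Fin.reduceFinMk, Matrix.cons_val]
  · convert hx using 1; push_cast; ring
  · convert hy using 1; push_cast; ring
  · convert hz using 1; push_cast; ring
  · convert V.hasVal_mul hx hδ using 1
    · push_cast; ring
    · linear_combination hxA
  · convert V.hasVal_add (V.hasVal_mul (V.hasVal_pow hx 3) hc)
      ((V.atLeast_neg (V.atLeast_mul hy.atLeast (V.atLeast_mul hδ.atLeast hlin))).moreThan ?_)
      using 1
    · push_cast; ring
    · linear_combination x ^ 2 * hxA + hBA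
    · push_cast; linarith
  · have hquad : AtLeast ν (2 * (2 * Real.sqrt 2 - 1))
        (((3 : ℕ) : Kex 𝕜) * A ^ 2 + ((3 : ℕ) : Kex 𝕜) * (A * δ) + δ ^ 2) := by
      refine V.atLeast_add (V.atLeast_add ?_ ?_) ?_
      · exact V.atLeast_natCast_mul 3 (V.atLeast_pow hA.atLeast 2)
      · exact V.atLeast_natCast_mul 3 ((V.atLeast_mul hA.atLeast hδA).mono (by linarith))
      · exact V.atLeast_pow hδA 2
    convert V.hasVal_add (V.hasVal_mul (V.hasVal_mul (V.hasVal_pow hx 2) hy) hc)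
      ((V.atLeast_neg (V.atLeast_mul hδ.atLeast hquad)).moreThan ?_) using 1
    · push_cast; ring
    · push_cast
      linear_combination x * y * hxA + hBA'
    · push_cast; linarith
  · have hmixed : AtLeast ν (4 * (2 * Real.sqrt 2 - 1))
        (((2 : ℕ) : Kex 𝕜) * (x ^ 2 * y * c * (2 * A + δ))) := by
      refine V.atLeast_natCast_mul 2 ((V.atLeast_mul (V.atLeast_mul (V.atLeast_mul
        (V.atLeast_pow hx.atLeast 2) hy.atLeast) hc.atLeast) hlin).mono ?_)
      push_cast; linarith
    have hquart : AtLeast ν (4 * (2 * Real.sqrt 2 - 1))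
        (A ^ 4 + ((8 : ℕ) : Kex 𝕜) * (A ^ 3 * δ) + ((10 : ℕ) : Kex 𝕜) * (A ^ 2 * δ ^ 2)
          + ((5 : ℕ) : Kex 𝕜) * (A * δ ^ 3) + δ ^ 4) := by
      have hpow (i j : ℕ) (hij : i + j = 4) :
          AtLeast ν (4 * (2 * Real.sqrt 2 - 1)) (A ^ i * δ ^ j) := by
        convert V.atLeast_mul (V.atLeast_pow hA.atLeast i) (V.atLeast_pow hδA j) using 1
        rw [← add_mul, ← Nat.cast_add, hij, Nat.cast_ofNat]
      refine V.atLeast_add (V.atLeast_add (V.atLeast_add (V.atLeast_add ?_ ?_) ?_) ?_) ?_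
      · simpa using hpow 4 0 rfl
      · simpa using V.atLeast_natCast_mul 8 (hpow 3 1 rfl)
      · exact V.atLeast_natCast_mul 10 (hpow 2 2 rfl)
      · simpa using V.atLeast_natCast_mul 5 (hpow 1 3 rfl)
      · simpa using hpow 0 4 rfl
    have hmain := V.hasVal_mul (V.hasVal_pow hx 5) (V.hasVal_pow hc 2)
    have hmain' : HasVal ν _ (-(x ^ 5 * c ^ 2)) :=
      ⟨neg_ne_zero.2 hmain.1, (V.map_neg _).trans hmain.2⟩
    convert V.hasVal_add hmain' ((V.atLeast_mul hδ.atLeast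
      (V.atLeast_add hmixed (V.atLeast_neg hquart))).moreThan ?_) using 1
    · push_cast; ring
    · push_cast
      linear_combination (2 * x * y * (A + δ) ^ 2 - x ^ 3 * (2 * x * δ + x * A - y ^ 2)) * hxA
        - hBA'' - 2 * c * x ^ 2 * hBA + 2 * (A + δ) ^ 2 * hBA'
    · push_cast; linarith

end Values

section NormalForm

variable {𝕜 : Type} [Field 𝕜]

/-- Exponents of the monomials `1, z, z², y, yz, Q₄, zQ₄, z²Q₄, Q₅, zQ₅` in the generators. -/
def baseExp : Fin 10 → Fin 7 → ℕ :=
  ![![0, 0, 0, 0, 0, 0, 0], ![0, 0, 1, 0, 0, 0, 0], ![0, 0, 2, 0, 0, 0, 0],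
    ![0, 1, 0, 0, 0, 0, 0], ![0, 1, 1, 0, 0, 0, 0], ![0, 0, 0, 0, 1, 0, 0],
    ![0, 0, 1, 0, 1, 0, 0], ![0, 0, 2, 0, 1, 0, 0], ![0, 0, 0, 0, 0, 1, 0],
    ![0, 0, 1, 0, 0, 1, 0]]

/-- Exponents of the standard monomials: a base monomial times powers of `x`, `Q₃`, `Q₆`. -/
def stdExp (s : Fin 10 × ℕ × ℕ × ℕ) : Fin 7 → ℕ :=
  baseExp s.1 + ![s.2.1, 0, 0, s.2.2.1, 0, 0, s.2.2.2]

/-- The monomial in the seven generators with exponents `b`. -/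
noncomputable def genMonomial (𝕜 : Type) [Field 𝕜] (b : Fin 7 → ℕ) : Kex 𝕜 :=
  ∏ ℓ, Qgen 𝕜 ℓ ^ b ℓ

theorem sum_stdExp_mul (i : Fin 10) (a d k : ℕ) (j : Fin 3) :
    ∑ ℓ, (stdExp (i, a, d, k) ℓ : ℤ) * initExp ℓ j =
      ∑ ℓ, (baseExp i ℓ : ℤ) * initExp ℓ j
        + (a * initExp 0 j + d * initExp 3 j + k * initExp 6 j) := by
  simp only [stdExp, Pi.add_apply, Nat.cast_add, add_mul, Finset.sum_add_distrib]
  simp [Fin.sum_univ_seven]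

theorem baseExp_eq_of_modEq (i i' : Fin 10) :
    (∑ ℓ, (baseExp i ℓ : ℤ) * initExp ℓ 1 - ∑ ℓ, (baseExp i' ℓ : ℤ) * initExp ℓ 1) % 5 = 0 →
    (∑ ℓ, (baseExp i ℓ : ℤ) * initExp ℓ 2 - ∑ ℓ, (baseExp i' ℓ : ℤ) * initExp ℓ 2) % 2 = 0 →
    i = i' := by
  revert i i'
  simp only [Fin.sum_univ_seven]
  decide

theorem weight_stdExp_injective : Function.Injective fun s =>
    weight fun i => ∑ ℓ, stdExp s ℓ * initExp ℓ i := by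
  rintro ⟨i, a, d, k⟩ ⟨i', a', d', k'⟩ h
  have h := weight_injective h
  have h0 := congrFun h 0
  have h1 := congrFun h 1
  have h2 := congrFun h 2
  simp only [sum_stdExp_mul] at h0 h1 h2
  have hi := baseExp_eq_of_modEq i i'
  simp only [initExp, Matrix.cons_val] at h0 h1 h2 hi
  obtain rfl := hi (by omega) (by omega)
  simp only [Prod.mk.injEq, true_and]
  omega

/-- The span of the standard monomials. -/
noncomputable def stdSpan (𝕜 : Type) [Field 𝕜] : Submodule 𝕜 (Kex 𝕜) :=
  Submodule.span 𝕜 (Set.range fun s => genMonomial 𝕜 (stdExp s))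

theorem genMonomial_stdExp_mem (s : Fin 10 × ℕ × ℕ × ℕ) :
    genMonomial 𝕜 (stdExp s) ∈ stdSpan 𝕜 :=
  Submodule.subset_span ⟨s, rfl⟩

theorem genMonomial_stdExp (i : Fin 10) (a d k p q r : ℕ) :
    genMonomial 𝕜 (stdExp (i, p + a, q + d, r + k)) =
      genMonomial 𝕜 (baseExp i) * (Qgen 𝕜 0 ^ p * Qgen 𝕜 3 ^ q * Qgen 𝕜 6 ^ r) *
        (Qgen 𝕜 0 ^ a * Qgen 𝕜 3 ^ d * Qgen 𝕜 6 ^ k) := by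
  simp only [genMonomial, stdExp, Fin.prod_univ_seven, Pi.add_apply, pow_add, Matrix.cons_val]
  ring

theorem mul_mem_stdSpan {w : Kex 𝕜}
    (hw : ∀ i a d k, w * genMonomial 𝕜 (stdExp (i, a, d, k)) ∈ stdSpan 𝕜)
    {f : Kex 𝕜} (hf : f ∈ stdSpan 𝕜) : w * f ∈ stdSpan 𝕜 := by
  induction hf using Submodule.span_induction with
  | mem f hf => obtain ⟨⟨i, a, d, k⟩, rfl⟩ := hf; exact hw i a d k
  | zero => rw [mul_zero]; exact zero_mem _
  | add f g _ _ hf hg => rw [mul_add]; exact add_mem hf hg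
  | smul c f _ hf => rw [mul_smul_comm]; exact Submodule.smul_mem _ c hf

theorem x_mul_mem_stdSpan {f : Kex 𝕜} (hf : f ∈ stdSpan 𝕜) : xv 𝕜 * f ∈ stdSpan 𝕜 := by
  refine mul_mem_stdSpan (fun i a d k => ?_) hf
  convert genMonomial_stdExp_mem (𝕜 := 𝕜) (i, 1 + a, 0 + d, 0 + k) using 1
  rw [genMonomial_stdExp]
  simp only [genMonomial, stdExp, Fin.prod_univ_seven, Pi.add_apply, pow_add, Matrix.cons_val]
  simp only [Qgen]
  ring

theorem y_mul_mem_stdSpan {f : Kex 𝕜} (hf : f ∈ stdSpan 𝕜) : yv 𝕜 * f ∈ stdSpan 𝕜 := by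
  refine mul_mem_stdSpan (fun i a d k => ?_) hf
  have key i p q r := genMonomial_stdExp_mem (𝕜 := 𝕜) (i, p + a, q + d, r + k)
  have hstd := genMonomial_stdExp (𝕜 := 𝕜) i a d k 0 0 0
  simp only [zero_add] at hstd
  rw [hstd]
  simp only [genMonomial_stdExp] at key
  generalize Qgen 𝕜 0 ^ a * Qgen 𝕜 3 ^ d * Qgen 𝕜 6 ^ k = t at key ⊢
  clear hstd
  fin_cases i
  · convert key 3 0 0 0 using 1
    simp [genMonomial, baseExp, Fin.prod_univ_seven, Qgen]
  · convert key 4 0 0 0 using 1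
    simp [genMonomial, baseExp, Fin.prod_univ_seven, Qgen]; ring
  · convert sub_mem (key 0 2 1 0) (key 5 0 0 0) using 1
    simp [genMonomial, baseExp, Fin.prod_univ_seven, Qgen]; ring
  · convert sub_mem (key 1 1 0 0) (key 0 0 1 0) using 1
    simp [genMonomial, baseExp, Fin.prod_univ_seven, Qgen]; ring
  · convert sub_mem (key 2 1 0 0) (key 1 0 1 0) using 1
    simp [genMonomial, baseExp, Fin.prod_univ_seven, Qgen]; ring
  · convert add_mem (key 8 1 0 0) (key 2 0 1 0) using 1
    simp [genMonomial, baseExp, Fin.prod_univ_seven, Qgen]; ring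
  · convert sub_mem (add_mem (key 9 1 0 0) (key 3 1 2 0)) (key 8 0 1 0) using 1
    simp [genMonomial, baseExp, Fin.prod_univ_seven, Qgen]; ring
  · convert sub_mem (add_mem (add_mem (key 5 2 1 0) (key 0 1 0 1)) (key 4 1 2 0))
      (key 9 0 1 0) using 1
    simp [genMonomial, baseExp, Fin.prod_univ_seven, Qgen]; ring
  · convert sub_mem (key 6 0 0 0) (key 0 1 2 0) using 1
    simp [genMonomial, baseExp, Fin.prod_univ_seven, Qgen]; ring
  · convert sub_mem (key 7 0 0 0) (key 1 1 2 0) using 1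
    simp [genMonomial, baseExp, Fin.prod_univ_seven, Qgen]; ring

theorem z_mul_mem_stdSpan {f : Kex 𝕜} (hf : f ∈ stdSpan 𝕜) : zel 𝕜 * f ∈ stdSpan 𝕜 := by
  refine mul_mem_stdSpan (fun i a d k => ?_) hf
  have key i p q r := genMonomial_stdExp_mem (𝕜 := 𝕜) (i, p + a, q + d, r + k)
  have hstd := genMonomial_stdExp (𝕜 := 𝕜) i a d k 0 0 0
  simp only [zero_add] at hstd
  rw [hstd]
  simp only [genMonomial_stdExp] at key
  generalize Qgen 𝕜 0 ^ a * Qgen 𝕜 3 ^ d * Qgen 𝕜 6 ^ k = t at key ⊢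
  clear hstd
  fin_cases i
  · convert key 1 0 0 0 using 1
    simp [genMonomial, baseExp, Fin.prod_univ_seven, Qgen]
  · convert key 2 0 0 0 using 1
    simp [genMonomial, baseExp, Fin.prod_univ_seven, Qgen]; ring
  · convert sub_mem (key 3 1 1 0) (key 8 0 0 0) using 1
    simp [genMonomial, baseExp, Fin.prod_univ_seven, Qgen]; ring
  · convert key 4 0 0 0 using 1
    simp [genMonomial, baseExp, Fin.prod_univ_seven, Qgen]; ring
  · convert sub_mem (key 0 2 1 0) (key 5 0 0 0) using 1
    simp [genMonomial, baseExp, Fin.prod_univ_seven, Qgen]; ring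
  · convert key 6 0 0 0 using 1
    simp [genMonomial, baseExp, Fin.prod_univ_seven, Qgen]; ring
  · convert key 7 0 0 0 using 1
    simp [genMonomial, baseExp, Fin.prod_univ_seven, Qgen]; ring
  · convert add_mem (add_mem (key 8 2 1 0) (add_mem (key 2 1 2 0) (key 2 1 2 0)))
      (key 3 0 0 1) using 1
    simp [genMonomial, baseExp, Fin.prod_univ_seven, Qgen]; ring
  · convert key 9 0 0 0 using 1
    simp [genMonomial, baseExp, Fin.prod_univ_seven, Qgen]; ring
  · convert add_mem (key 5 1 1 0) (key 0 0 0 1) using 1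
    simp [genMonomial, baseExp, Fin.prod_univ_seven, Qgen]; ring

theorem evz_C (c : 𝕜) : evz 𝕜 (MvPolynomial.C c) = algebraMap 𝕜 (Kex 𝕜) c := by
  rw [IsScalarTower.algebraMap_apply 𝕜 (MvPolynomial (Fin 3) 𝕜) (Kex 𝕜)]
  simp [evz, emb]

theorem evz_X (i : Fin 3) : evz 𝕜 (MvPolynomial.X i) = ![xv 𝕜, yv 𝕜, zel 𝕜] i := by
  fin_cases i <;> simp [evz]

theorem evz_mem_stdSpan (p : MvPolynomial (Fin 3) 𝕜) : evz 𝕜 p ∈ stdSpan 𝕜 := by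
  induction p using MvPolynomial.induction_on with
  | C c =>
    rw [evz_C, Algebra.algebraMap_eq_smul_one]
    refine Submodule.smul_mem _ c ?_
    convert genMonomial_stdExp_mem (𝕜 := 𝕜) (0, 0, 0, 0) using 1
    simp [genMonomial, stdExp, baseExp, Fin.prod_univ_seven]
  | add p q hp hq => rw [map_add]; exact add_mem hp hq
  | mul_X p i hp =>
    rw [map_mul, evz_X, mul_comm]
    fin_cases i
    · exact x_mul_mem_stdSpan hp
    · exact y_mul_mem_stdSpan hp
    · exact z_mul_mem_stdSpan hp

end NormalForm

section LocalRing

variable {𝕜 : Type} [Field 𝕜] {ν : Kex 𝕜 → ℝ}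

theorem IsMonomialValuation.atLeast_algebraMap (hν : IsMonomialValuation 𝕜 ν) (c : 𝕜) :
    AtLeast ν 0 (algebraMap 𝕜 (Kex 𝕜) c) := by
  rcases eq_or_ne c 0 with rfl | hc
  · exact Or.inl (map_zero _)
  · right
    rw [IsScalarTower.algebraMap_apply 𝕜 (MvPolynomial (Fin 3) 𝕜) (Kex 𝕜)]
    exact (hν.htriv c hc).ge

theorem IsMonomialValuation.hasVal_algebraMap (hν : IsMonomialValuation 𝕜 ν) {c : 𝕜}
    (hc : c ≠ 0) : HasVal ν 0 (algebraMap 𝕜 (Kex 𝕜) c) := by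
  refine ⟨by simpa using hc, ?_⟩
  rw [IsScalarTower.algebraMap_apply 𝕜 (MvPolynomial (Fin 3) 𝕜) (Kex 𝕜)]
  exact hν.htriv c hc

theorem one_le_weight_initExp (ℓ : Fin 7) : 1 ≤ weight (initExp ℓ) := by
  obtain ⟨l2, u2⟩ := sqrt_two_bounds
  obtain ⟨l51, u51⟩ := sqrt_fiftyOne_bounds
  fin_cases ℓ <;> simp [weight, initExp] <;> linarith

theorem IsMonomialValuation.atLeast_evz_X (hν : IsMonomialValuation 𝕜 ν) (i : Fin 3) :
    AtLeast ν 1 (evz 𝕜 (MvPolynomial.X i)) := by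
  have h ℓ := (hν.hasVal_Qgen ℓ).atLeast.mono (one_le_weight_initExp ℓ)
  rw [evz_X]
  fin_cases i
  · exact h 0
  · exact h 1
  · exact h 2

theorem IsMonomialValuation.atLeast_evz (hν : IsMonomialValuation 𝕜 ν)
    (p : MvPolynomial (Fin 3) 𝕜) : AtLeast ν 0 (evz 𝕜 p) := by
  have V := hν.isAddValuation
  induction p using MvPolynomial.induction_on with
  | C c => rw [evz_C]; exact hν.atLeast_algebraMap c
  | add p q hp hq => rw [map_add]; exact V.atLeast_add hp hq
  | mul_X p i hp =>
    rw [map_mul]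
    exact (V.atLeast_mul hp (hν.atLeast_evz_X i)).mono (by norm_num)

theorem IsMonomialValuation.atLeast_evz_sub (hν : IsMonomialValuation 𝕜 ν)
    (p : MvPolynomial (Fin 3) 𝕜) :
    AtLeast ν 1 (evz 𝕜 p - algebraMap 𝕜 (Kex 𝕜) (MvPolynomial.constantCoeff p)) := by
  have V := hν.isAddValuation
  induction p using MvPolynomial.induction_on with
  | C c => left; simp [evz_C]
  | add p q hp hq =>
    convert V.atLeast_add hp hq using 1
    simp only [map_add]; ring
  | mul_X p i hp =>
    convert V.atLeast_mul (hν.atLeast_evz p) (hν.atLeast_evz_X i) using 1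
    · ring
    · simp

theorem IsMonomialValuation.hasVal_evz (hν : IsMonomialValuation 𝕜 ν)
    {q : MvPolynomial (Fin 3) 𝕜} (hq : MvPolynomial.coeff 0 q ≠ 0) :
    HasVal ν 0 (evz 𝕜 q) := by
  have := hν.isAddValuation.hasVal_add
    (hν.hasVal_algebraMap (c := MvPolynomial.constantCoeff q) hq)
    ((hν.atLeast_evz_sub q).moreThan one_pos)
  rwa [add_sub_cancel] at this

theorem IsMonomialValuation.atLeast_of_mem (hν : IsMonomialValuation 𝕜 ν) {f : Kex 𝕜}
    (hf : f ∈ Rloc 𝕜) : AtLeast ν 0 f := by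
  obtain ⟨p, q, hq, rfl⟩ := hf
  have V := hν.isAddValuation
  have hinv := (V.hasVal_div V.hasVal_one (hν.hasVal_evz hq)).atLeast
  convert V.atLeast_mul (hν.atLeast_evz p) hinv using 1
  · norm_num
  · rw [mul_one_div]

theorem evz_mem_Rloc (p : MvPolynomial (Fin 3) 𝕜) : evz 𝕜 p ∈ Rloc 𝕜 :=
  ⟨p, 1, by simp, by simp⟩

theorem mul_mem_Rloc {f g : Kex 𝕜} (hf : f ∈ Rloc 𝕜) (hg : g ∈ Rloc 𝕜) : f * g ∈ Rloc 𝕜 := by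
  obtain ⟨p, q, hq, rfl⟩ := hf
  obtain ⟨p', q', hq', rfl⟩ := hg
  refine ⟨p * p', q * q', ?_, by rw [map_mul, map_mul, div_mul_div_comm]⟩
  rw [← MvPolynomial.constantCoeff_eq] at *
  rw [map_mul]
  exact mul_ne_zero hq hq'

theorem IsMonomialValuation.add_mem_Rloc (hν : IsMonomialValuation 𝕜 ν) {f g : Kex 𝕜}
    (hf : f ∈ Rloc 𝕜) (hg : g ∈ Rloc 𝕜) : f + g ∈ Rloc 𝕜 := by
  obtain ⟨p, q, hq, rfl⟩ := hf
  obtain ⟨p', q', hq', rfl⟩ := hg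
  refine ⟨p * q' + q * p', q * q', ?_, ?_⟩
  · rw [← MvPolynomial.constantCoeff_eq] at *
    rw [map_mul]
    exact mul_ne_zero hq hq'
  · rw [div_add_div _ _ (hν.hasVal_evz hq).1 (hν.hasVal_evz hq').1]
    simp only [map_add, map_mul]

theorem Qgen_mem_Rloc (ℓ : Fin 7) : Qgen 𝕜 ℓ ∈ Rloc 𝕜 := by
  let x : MvPolynomial (Fin 3) 𝕜 := MvPolynomial.X 0
  let y : MvPolynomial (Fin 3) 𝕜 := MvPolynomial.X 1
  let z : MvPolynomial (Fin 3) 𝕜 := MvPolynomial.X 2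
  have hx : evz 𝕜 x = xv 𝕜 := evz_X 0
  have hy : evz 𝕜 y = yv 𝕜 := evz_X 1
  have hz : evz 𝕜 z = zel 𝕜 := evz_X 2
  convert evz_mem_Rloc (𝕜 := 𝕜) (![x, y, z, x * z - y ^ 2, x ^ 3 * z - x ^ 2 * y ^ 2 - y * z ^ 2,
    x ^ 2 * y * z - x * y ^ 3 - z ^ 3,
    -(x ^ 5 * z ^ 2) + 2 * x ^ 4 * y ^ 2 * z - x ^ 3 * y ^ 4
      + 2 * x ^ 2 * y * z ^ 3 - 2 * x * y ^ 3 * z ^ 2 - z ^ 5] ℓ) using 1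
  have h2 : evz 𝕜 2 = 2 := map_ofNat _ 2
  fin_cases ℓ <;> simp [Qgen, hx, hy, hz, h2]

theorem genMonomial_mem_Rloc (b : Fin 7 → ℕ) : genMonomial 𝕜 b ∈ Rloc 𝕜 := by
  have one_mem : (1 : Kex 𝕜) ∈ Rloc 𝕜 := by simpa using evz_mem_Rloc (𝕜 := 𝕜) 1
  refine Finset.prod_induction _ (· ∈ Rloc 𝕜) (fun _ _ => mul_mem_Rloc) one_mem fun ℓ _ => ?_
  induction b ℓ with
  | zero => simpa using one_mem
  | succ n ih => rw [pow_succ]; exact mul_mem_Rloc ih (Qgen_mem_Rloc ℓ)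

theorem IsMonomialValuation.hasVal_genMonomial (hν : IsMonomialValuation 𝕜 ν)
    (b : Fin 7 → ℕ) :
    HasVal ν (weight fun i => ∑ ℓ, b ℓ * initExp ℓ i) (genMonomial 𝕜 b) := by
  rw [← sum_mul_weight]
  exact hν.isAddValuation.hasVal_prod _ fun ℓ _ =>
    hν.isAddValuation.hasVal_pow (hν.hasVal_Qgen ℓ) (b ℓ)

theorem IsMonomialValuation.sum_mul_val_Qgen (hν : IsMonomialValuation 𝕜 ν) (b : Fin 7 → ℕ) :
    ∑ ℓ, (b ℓ : ℝ) * ν (Qgen 𝕜 ℓ) = ν (genMonomial 𝕜 b) := by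
  rw [(hν.hasVal_genMonomial b).2, ← sum_mul_weight]
  exact Finset.sum_congr rfl fun ℓ _ => by rw [(hν.hasVal_Qgen ℓ).2]

/-- A polynomial in `x, y, z` of value at least `σ` is a linear combination of standard
monomials of value at least `σ`. -/
theorem IsMonomialValuation.exists_finsupp_evz (hν : IsMonomialValuation 𝕜 ν)
    (p : MvPolynomial (Fin 3) 𝕜) {σ : ℝ} (hp : AtLeast ν σ (evz 𝕜 p)) :
    ∃ c : (Fin 10 × ℕ × ℕ × ℕ) →₀ 𝕜,
      evz 𝕜 p = ∑ s ∈ c.support, algebraMap 𝕜 (Kex 𝕜) (c s) * genMonomial 𝕜 (stdExp s) ∧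
      ∀ s ∈ c.support, σ ≤ ν (genMonomial 𝕜 (stdExp s)) := by
  have V := hν.isAddValuation
  obtain ⟨c, hc⟩ := Finsupp.mem_span_range_iff_exists_finsupp.1 (evz_mem_stdSpan p)
  have hsum : evz 𝕜 p =
      ∑ s ∈ c.support, algebraMap 𝕜 (Kex 𝕜) (c s) * genMonomial 𝕜 (stdExp s) := by
    rw [← hc]
    exact Finset.sum_congr rfl fun s _ => Algebra.smul_def _ _
  have hterm : ∀ s ∈ c.support, HasVal ν (weight fun i => ∑ ℓ, stdExp s ℓ * initExp ℓ i)
      (algebraMap 𝕜 (Kex 𝕜) (c s) * genMonomial 𝕜 (stdExp s)) := fun s hs => by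
    simpa only [zero_add] using V.hasVal_mul
      (hν.hasVal_algebraMap (Finsupp.mem_support_iff.1 hs)) (hν.hasVal_genMonomial (stdExp s))
  refine ⟨c, hsum, fun s hs => ?_⟩
  rw [(hν.hasVal_genMonomial _).2, ← (hterm s hs).2]
  rw [hsum] at hp
  refine V.le_of_atLeast_sum c.support (fun s hs => (hterm s hs).1) ?_ hp s hs
  intro s hs t ht hst
  simp only [(hterm s hs).2, (hterm t ht).2] at hst
  exact weight_stdExp_injective hst

theorem IsMonomialValuation.isGenSeqOn_univ (hν : IsMonomialValuation 𝕜 ν) :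
    IsGenSeqOn 𝕜 ν Set.univ := by
  have V := hν.isAddValuation
  rintro σ -
  ext f
  constructor
  · rintro ⟨⟨p, q, hq, rfl⟩, hf⟩
    have hq' := hν.hasVal_evz hq
    have hp : AtLeast ν σ (evz 𝕜 p) := by
      convert V.atLeast_mul (show AtLeast ν σ _ from hf) hq'.atLeast using 1
      · rw [add_zero]
      · rw [div_mul_cancel₀ _ hq'.1]
    obtain ⟨c, hc, hσ⟩ := hν.exists_finsupp_evz p hp
    let e := c.support.equivFin.symm
    refine ⟨_, fun n => evz 𝕜 (MvPolynomial.C (c (e n))) / evz 𝕜 q, fun n => stdExp (e n),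
      fun n => ⟨_, q, hq, rfl⟩, fun _ _ _ => Set.mem_univ _, fun n => ?_, ?_⟩
    · rw [hν.sum_mul_val_Qgen]
      exact hσ _ (e n).2
    · rw [hc, Finset.sum_div, ← Finset.sum_coe_sort, ← e.sum_comp]
      refine Finset.sum_congr rfl fun n _ => ?_
      beta_reduce
      rw [evz_C, div_mul_eq_mul_div]
      rfl
  · rintro ⟨M, g, b, hg, -, hb, rfl⟩
    refine ⟨Finset.sum_induction _ (· ∈ Rloc 𝕜) (fun _ _ => hν.add_mem_Rloc)
      (by simpa using evz_mem_Rloc (𝕜 := 𝕜) 0)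
      fun e _ => mul_mem_Rloc (hg e) (genMonomial_mem_Rloc (b e)), ?_⟩
    refine V.atLeast_sum _ fun e _ => ?_
    have hbe := hb e
    rw [hν.sum_mul_val_Qgen] at hbe
    rw [← zero_add σ]
    exact V.atLeast_mul (hν.atLeast_of_mem (hg e)) (Or.inr hbe)

theorem sum_mul_initExp_ne (ℓ : Fin 7) (b : Fin 7 → ℕ) (hb : b ℓ = 0) :
    (fun i => ∑ j, b j * initExp j i) ≠ initExp ℓ := by
  intro h
  have h0 := congrFun h 0
  have h1 := congrFun h 1
  have h2 := congrFun h 2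
  clear h
  have h3 : b 3 = 0 := by
    fin_cases ℓ <;> simp [initExp, Fin.sum_univ_seven] at h0 h1 h2 hb <;> omega
  fin_cases ℓ <;> simp [initExp, Fin.sum_univ_seven, h3] at h0 h1 h2 hb <;> omega

theorem IsMonomialValuation.mem_of_isGenSeqOn (hν : IsMonomialValuation 𝕜 ν) {s : Set (Fin 7)}
    (hs : IsGenSeqOn 𝕜 ν s) (ℓ : Fin 7) : ℓ ∈ s := by
  have V := hν.isAddValuation
  by_contra hℓ
  have hQ := hν.hasVal_Qgen ℓ
  obtain ⟨M, g, b, hg, hbs, hb, hsum⟩ :=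
    (hs _ ⟨Qgen 𝕜 ℓ, Qgen_mem_Rloc ℓ, hQ.1, hQ.2⟩).le ⟨Qgen_mem_Rloc ℓ, Or.inr hQ.2.ge⟩
  have hmore : MoreThan ν (weight (initExp ℓ)) (Qgen 𝕜 ℓ) := by
    rw [hsum]
    refine V.moreThan_sum _ fun e _ => ?_
    have hbe := hb e
    rw [hν.sum_mul_val_Qgen, (hν.hasVal_genMonomial _).2] at hbe
    have hℓe : b e ℓ = 0 := by
      by_contra h
      exact hℓ (hbs e ℓ h)
    have hlt := lt_of_le_of_ne hbe
      fun h => sum_mul_initExp_ne ℓ (b e) hℓe (weight_injective h).symm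
    refine (V.atLeast_mul (hν.atLeast_of_mem (hg e))
      (hν.hasVal_genMonomial (b e)).atLeast).moreThan ?_
    rwa [zero_add]
  rcases hmore with h | h
  · exact hQ.1 h
  · exact h.ne' hQ.2

end LocalRing

/-- The seven elements `x, y, z, xz − y², x³z − x²y² − yz²,
x²yz − xy³ − z³, −x⁵z² + 2x⁴y²z − x³y⁴ + 2x²yz³ − 2xy³z² − z⁵` form a minimal
generating sequence of `ν` in `R = 𝕜[x, y, z]_{(x, y, z)}`. -/
theorem minimal_generating_sequence (𝕜 : Type) [Field 𝕜] (ν : Kex 𝕜 → ℝ)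
    (hν : IsMonomialValuation 𝕜 ν) :
    IsGenSeqOn 𝕜 ν Set.univ ∧
    ∀ s : Set (Fin 7), s ⊂ Set.univ → ¬ IsGenSeqOn 𝕜 ν s := by
  refine ⟨hν.isGenSeqOn_univ, fun s hs hgen => hs.2 fun ℓ _ => hν.mem_of_isGenSeqOn hgen ℓ⟩

end JumpExample
end
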